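/- Let F : (0,∞) × ℝ → ℂ be smooth in polar coordinates (r,φ), representing a smooth function f on ℂ∖{0} via f(r e^{iφ}) = F(r,φ). For every natural number η and every point with r > 0, the iterated Wirtinger derivatives admit the polar-coordinate factorizations (∂_{α*})^η f = e^{iηφ} · (D_{η−1} ∘ ⋯ ∘ D_1 ∘ D_0) F and (∂_α)^η f = e^{−iηφ} · (D̄_{η−1} ∘ ⋯ ∘ D̄_1 ∘ D̄_0) F, where D_k G := (1/2)(−(k/r)·G + ∂_r G + (i/r) ∂_φ G), D̄_k G := (1/2)(−(k/r)·G + ∂_r G − (i/r) ∂_φ G), and the factor with k = 0 is applied first. -/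

import Mathlib

open Complex

/-- Partial derivative in the first (radial) variable. -/
noncomputable def pdR (F : ℝ × ℝ → ℂ) : ℝ × ℝ → ℂ :=
  fun p => deriv (fun t => F (t, p.2)) p.1

/-- Partial derivative in the second (angular) variable. -/
noncomputable def pdPhi (F : ℝ × ℝ → ℂ) : ℝ × ℝ → ℂ :=
  fun p => deriv (fun t => F (p.1, t)) p.2

/-- Wirtinger derivative `∂_α f = (∂_x f − i ∂_y f)/2`. -/
noncomputable def wirt (f : ℂ → ℂ) : ℂ → ℂ :=
  fun z => (fderiv ℝ f z 1 - Complex.I * fderiv ℝ f z Complex.I) / 2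

/-- Conjugate Wirtinger derivative `∂_{α*} f = (∂_x f + i ∂_y f)/2`. -/
noncomputable def wirtBar (f : ℂ → ℂ) : ℂ → ℂ :=
  fun z => (fderiv ℝ f z 1 + Complex.I * fderiv ℝ f z Complex.I) / 2

/-- The polar first-order factor `D_k G = (1/2)(−(k/r)G + ∂_r G + (i/r)∂_φ G)`. -/
noncomputable def Dfac (k : ℕ) (G : ℝ × ℝ → ℂ) : ℝ × ℝ → ℂ :=
  fun p => (1 / 2 : ℂ) *
    (-((k : ℂ) / (p.1 : ℂ)) * G p + pdR G p + (Complex.I / (p.1 : ℂ)) * pdPhi G p)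

/-- The conjugate polar factor `D̄_k G = (1/2)(−(k/r)G + ∂_r G − (i/r)∂_φ G)`. -/
noncomputable def DfacBar (k : ℕ) (G : ℝ × ℝ → ℂ) : ℝ × ℝ → ℂ :=
  fun p => (1 / 2 : ℂ) *
    (-((k : ℂ) / (p.1 : ℂ)) * G p + pdR G p - (Complex.I / (p.1 : ℂ)) * pdPhi G p)

/-- `D_{η−1} ∘ ⋯ ∘ D_1 ∘ D_0`, the `k = 0` factor applied first. -/
noncomputable def iterD : ℕ → (ℝ × ℝ → ℂ) → (ℝ × ℝ → ℂ)
  | 0, G => G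
  | n + 1, G => Dfac n (iterD n G)

/-- `D̄_{η−1} ∘ ⋯ ∘ D̄_1 ∘ D̄_0`, the `k = 0` factor applied first. -/
noncomputable def iterDBar : ℕ → (ℝ × ℝ → ℂ) → (ℝ × ℝ → ℂ)
  | 0, G => G
  | n + 1, G => DfacBar n (iterDBar n G)

theorem aux_smooth_bar (f : ℂ → ℂ) (hf : ContDiffOn ℝ (⊤ : ℕ∞) f {0}ᶜ) (n : ℕ) :
    ContDiffOn ℝ (⊤ : ℕ∞) (wirtBar^[n] f) {0}ᶜ := by
  induction n with
  | zero => simpa using hf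
  | succ n ih =>
    rw [Function.iterate_succ_apply']
    have h := ih.fderiv_of_isOpen (m := ((⊤ : ℕ∞) : WithTop ℕ∞)) isOpen_compl_singleton (by simp)
    unfold wirtBar
    exact ((h.clm_apply contDiffOn_const).add
      (contDiffOn_const.mul (h.clm_apply contDiffOn_const))).div_const _

theorem aux_smooth (f : ℂ → ℂ) (hf : ContDiffOn ℝ (⊤ : ℕ∞) f {0}ᶜ) (n : ℕ) :
    ContDiffOn ℝ (⊤ : ℕ∞) (wirt^[n] f) {0}ᶜ := by
  induction n with
  | zero => simpa using hf
  | succ n ih =>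
    rw [Function.iterate_succ_apply']
    have h := ih.fderiv_of_isOpen (m := ((⊤ : ℕ∞) : WithTop ℕ∞)) isOpen_compl_singleton (by simp)
    unfold wirt
    exact ((h.clm_apply contDiffOn_const).sub
      (contDiffOn_const.mul (h.clm_apply contDiffOn_const))).div_const _

theorem aux_polar (g : ℂ → ℂ) (G : ℝ × ℝ → ℂ) (m : ℂ)
    (hg : ContDiffOn ℝ (⊤ : ℕ∞) g {0}ᶜ)
    (h : ∀ r φ : ℝ, 0 < r →
      g ((r : ℂ) * Complex.exp (Complex.I * (φ : ℂ))) = Complex.exp (m * φ) * G (r, φ))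
    (r φ : ℝ) (hr : 0 < r) :
    Complex.exp (m * φ) * pdR G (r, φ) =
      fderiv ℝ g ((r : ℂ) * Complex.exp (Complex.I * (φ : ℂ))) 1 * (Real.cos φ : ℂ) +
      fderiv ℝ g ((r : ℂ) * Complex.exp (Complex.I * (φ : ℂ))) Complex.I * (Real.sin φ : ℂ) ∧
    Complex.exp (m * φ) * pdPhi G (r, φ) = - m * (Complex.exp (m * φ) * G (r, φ)) +
      r * (fderiv ℝ g ((r : ℂ) * Complex.exp (Complex.I * (φ : ℂ))) Complex.I * (Real.cos φ : ℂ) -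
      fderiv ℝ g ((r : ℂ) * Complex.exp (Complex.I * (φ : ℂ))) 1 * (Real.sin φ : ℂ)) := by
  have hG : ∀ r φ : ℝ, 0 < r → G (r, φ) =
      Complex.exp (-(m * φ)) * g ((r : ℂ) * Complex.exp (Complex.I * (φ : ℂ))) := by
    intro r φ hr
    rw [h r φ hr, ← mul_assoc, ← Complex.exp_add]; simp
  have hz : (r : ℂ) * Complex.exp (Complex.I * (φ : ℂ)) ≠ 0 :=
    mul_ne_zero (by exact_mod_cast hr.ne') (Complex.exp_ne_zero _)
  have hd : HasFDerivAt g (fderiv ℝ g ((r : ℂ) * Complex.exp (Complex.I * (φ : ℂ))))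
      ((r : ℂ) * Complex.exp (Complex.I * (φ : ℂ))) :=
    ((hg.contDiffAt (isOpen_compl_singleton.mem_nhds hz)).differentiableAt (by simp)).hasFDerivAt
  set L := fderiv ℝ g ((r : ℂ) * Complex.exp (Complex.I * (φ : ℂ))) with hL
  have hlin : ∀ a b : ℝ, L ((a : ℂ) + b * Complex.I) = a * L 1 + b * L Complex.I := by
    intro a b
    have : (a : ℂ) + b * Complex.I = a • (1 : ℂ) + b • Complex.I := by simp
    rw [this, map_add, map_smul, map_smul]; simp
  have he : Complex.exp (Complex.I * (φ : ℂ)) = (Real.cos φ : ℂ) + (Real.sin φ : ℂ) * Complex.I := by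
    rw [mul_comm, Complex.exp_mul_I]; simp
  have hexp : Complex.exp (m * φ) * Complex.exp (-(m * φ)) = 1 := by
    rw [← Complex.exp_add]; simp
  constructor
  · have h1 : HasDerivAt (fun t : ℝ => (t : ℂ) * Complex.exp (Complex.I * (φ : ℂ)))
        (1 * Complex.exp (Complex.I * (φ : ℂ))) r :=
      (Complex.ofRealCLM.hasDerivAt (x := r)).mul_const _
    have h2 := (hd.comp_hasDerivAt r h1).const_mul (Complex.exp (-(m * φ)))
    have h3 : (fun t : ℝ => G (t, φ)) =ᶠ[nhds r] fun t : ℝ => Complex.exp (-(m * φ)) *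
        (g ∘ fun t : ℝ => (t : ℂ) * Complex.exp (Complex.I * (φ : ℂ))) t := by
      filter_upwards [lt_mem_nhds hr] with t ht
      exact hG t φ ht
    have h4 : pdR G (r, φ) = _ := (h2.congr_of_eventuallyEq h3).deriv
    rw [h4, ← mul_assoc, hexp, one_mul, one_mul, he, hlin]; ring
  · have h0 : HasDerivAt (fun t : ℝ => (t : ℂ)) 1 φ := Complex.ofRealCLM.hasDerivAt (x := φ)
    have h1 : HasDerivAt (fun t : ℝ => (r : ℂ) * Complex.exp (Complex.I * (t : ℂ)))
        (r * (Complex.exp (Complex.I * (φ : ℂ)) * (Complex.I * 1))) φ :=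
      ((h0.const_mul Complex.I).cexp).const_mul _
    have h1' : HasDerivAt (fun t : ℝ => Complex.exp (-(m * (t : ℂ))))
        (Complex.exp (-(m * (φ : ℂ))) * (-(m * 1))) φ := ((h0.const_mul m).neg).cexp
    have h2 := h1'.mul (hd.comp_hasDerivAt φ h1)
    have h3 : (fun t : ℝ => G (r, t)) = (fun t : ℝ => Complex.exp (-(m * (t : ℂ)))) *
        (g ∘ fun t : ℝ => (r : ℂ) * Complex.exp (Complex.I * (t : ℂ))) := by
      funext t
      exact hG r t hr
    rw [← h3] at h2
    have h4 : pdPhi G (r, φ) = _ := h2.deriv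
    have h5 : (r : ℂ) * (Complex.exp (Complex.I * (φ : ℂ)) * (Complex.I * 1)) =
        ((-(r * Real.sin φ) : ℝ) : ℂ) + ((r * Real.cos φ : ℝ) : ℂ) * Complex.I := by
      rw [he]; push_cast; linear_combination (r * Complex.sin φ) * Complex.I_mul_I
    rw [h4, h5, hlin, ← h r φ hr]
    simp only [Function.comp]
    push_cast
    linear_combination (-m * g ((r : ℂ) * Complex.exp (Complex.I * (φ : ℂ))) +
      r * (L Complex.I * Complex.cos φ - L 1 * Complex.sin φ)) * hexp

/-- Polar-coordinate factorization of iterated Wirtinger derivatives: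
if `f(r e^{iφ}) = F(r,φ)`, then `(∂_{α*})^η f = e^{iηφ}(D_{η−1}∘⋯∘D_0)F` and
`(∂_α)^η f = e^{−iηφ}(D̄_{η−1}∘⋯∘D̄_0)F`. -/
theorem iterated_wirtinger_polar (f : ℂ → ℂ) (F : ℝ × ℝ → ℂ)
    (hf : ContDiffOn ℝ (⊤ : ℕ∞) f {0}ᶜ)
    (hF : ContDiffOn ℝ (⊤ : ℕ∞) F {p | 0 < p.1})
    (hrel : ∀ r φ : ℝ, 0 < r → f ((r : ℂ) * Complex.exp (Complex.I * (φ : ℂ))) = F (r, φ))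
    (η : ℕ) (r φ : ℝ) (hr : 0 < r) :
    (wirtBar^[η] f) ((r : ℂ) * Complex.exp (Complex.I * (φ : ℂ))) =
        Complex.exp (Complex.I * (η : ℂ) * (φ : ℂ)) * iterD η F (r, φ) ∧
    (wirt^[η] f) ((r : ℂ) * Complex.exp (Complex.I * (φ : ℂ))) =
        Complex.exp (-(Complex.I * (η : ℂ) * (φ : ℂ))) * iterDBar η F (r, φ) := by
  constructor
  · induction η generalizing r φ with
    | zero => simpa [iterD] using hrel r φ hr
    | succ n ih =>
      obtain ⟨h1, h2⟩ := aux_polar (wirtBar^[n] f) (iterD n F) (Complex.I * n)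
        (aux_smooth_bar f hf n) (fun r φ hr => ih r φ hr) r φ hr
      rw [Function.iterate_succ_apply']
      have hE : Complex.exp (Complex.I * ((n + 1 : ℕ) : ℂ) * (φ : ℂ)) =
          Complex.exp (Complex.I * n * φ) * ((Real.cos φ : ℂ) + (Real.sin φ : ℂ) * Complex.I) := by
        rw [Complex.ofReal_cos, Complex.ofReal_sin, ← Complex.exp_mul_I, ← Complex.exp_add]
        congr 1; push_cast; ring
      have hr' : (r : ℂ) ≠ 0 := by exact_mod_cast hr.ne'
      have hcs : (Real.cos φ : ℂ) ^ 2 + (Real.sin φ : ℂ) ^ 2 = 1 := by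
        exact_mod_cast Real.cos_sq_add_sin_sq φ
      have hI := Complex.I_sq
      rw [hE]
      simp only [iterD, Dfac, wirtBar]
      generalize fderiv ℝ (wirtBar^[n] f) _ 1 = A at *
      generalize fderiv ℝ (wirtBar^[n] f) _ Complex.I = B at *
      generalize Complex.exp (Complex.I * n * φ) = E at *
      generalize pdR (iterD n F) (r, φ) = P at *
      generalize pdPhi (iterD n F) (r, φ) = Q at *
      generalize iterD n F (r, φ) = G at *
      generalize (Real.cos φ : ℂ) = c at *
      generalize (Real.sin φ : ℂ) = s at *
      have key : E * (-((n : ℂ) / r) * G + P + Complex.I / r * Q) =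
          (A * c + B * s) + Complex.I * (B * c - A * s) := by
        field_simp
        linear_combination r * h1 + Complex.I * h2 - n * E * G * hI
      linear_combination (-(c + s * Complex.I) / 2) * key - (A + Complex.I * B) / 2 * hcs +
        (A * s ^ 2 - B * c * s) / 2 * hI
  · induction η generalizing r φ with
    | zero => simpa [iterDBar] using hrel r φ hr
    | succ n ih =>
      obtain ⟨h1, h2⟩ := aux_polar (wirt^[n] f) (iterDBar n F) (-(Complex.I * n))
        (aux_smooth f hf n) (fun r φ hr => by rw [ih r φ hr, neg_mul]) r φ hr
      rw [Function.iterate_succ_apply']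
      have hE : Complex.exp (-(Complex.I * ((n + 1 : ℕ) : ℂ) * (φ : ℂ))) =
          Complex.exp (-(Complex.I * n) * φ) *
            ((Real.cos φ : ℂ) - (Real.sin φ : ℂ) * Complex.I) := by
        have : (Real.cos φ : ℂ) - (Real.sin φ : ℂ) * Complex.I =
            Complex.exp (-φ * Complex.I) := by
          rw [Complex.exp_mul_I]; simp [sub_eq_add_neg]
        rw [this, ← Complex.exp_add]
        congr 1; push_cast; ring
      have hr' : (r : ℂ) ≠ 0 := by exact_mod_cast hr.ne'
      have hcs : (Real.cos φ : ℂ) ^ 2 + (Real.sin φ : ℂ) ^ 2 = 1 := by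
        exact_mod_cast Real.cos_sq_add_sin_sq φ
      have hI := Complex.I_sq
      rw [hE]
      simp only [iterDBar, DfacBar, wirt]
      generalize fderiv ℝ (wirt^[n] f) _ 1 = A at *
      generalize fderiv ℝ (wirt^[n] f) _ Complex.I = B at *
      generalize Complex.exp (-(Complex.I * n) * φ) = E at *
      generalize pdR (iterDBar n F) (r, φ) = P at *
      generalize pdPhi (iterDBar n F) (r, φ) = Q at *
      generalize iterDBar n F (r, φ) = G at *
      generalize (Real.cos φ : ℂ) = c at *
      generalize (Real.sin φ : ℂ) = s at *
      have key : E * (-((n : ℂ) / r) * G + P - Complex.I / r * Q) =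
          (A * c + B * s) - Complex.I * (B * c - A * s) := by
        field_simp
        linear_combination r * h1 - Complex.I * h2 - n * E * G * hI
      linear_combination (-(c - s * Complex.I) / 2) * key - (A - Complex.I * B) / 2 * hcs +
        (A * s ^ 2 - B * c * s) / 2 * hI
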